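/- arXiv:2009.00586 — 2 statements merged into one kernel-verified Lean document; each statement's English description precedes it below -/
import Mathlib

section
/- For every natural number n, the additive group of all integer-coefficient linear functionals on ℝ^P (where P is the set of 2-element subsets of {1,…,n}) that vanish identically on the image of the linear map φ : ℝⁿ → ℝ^P, φ(x)_{{i,j}} = x_i + x_j, is generated by the functionals F_{(i,j,k,l)} : y ↦ y_{{i,j}} + y_{{k,l}} − y_{{i,k}} − y_{{j,l}}, where (i,j,k,l) ranges over all quadruples of pairwise distinct elements of {1,…,n}. Equivalently, a coefficient vector a ∈ ℤ^P satisfies Σ_{{i,j}∈P} a_{{i,j}}·(x_i + x_j) = 0 for all x ∈ ℝⁿ if and only if a is an integer linear combination of the vectors δ_{{i,j}} + δ_{{k,l}} − δ_{{i,k}} − δ_{{j,l}} for pairwise distinct i,j,k,l, where δ_p denotes the standard basis vector of ℝ^P indexed by p ∈ P. -/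
open scoped BigOperators

/-- The standard basis vector at `s` (zero if `s` is not a pair). -/
def pairDelta (n : ℕ) (s : Finset (Fin n)) : {s : Finset (Fin n) // s.card = 2} → ℤ :=
  fun q => if q.val = s then 1 else 0

lemma sum_pairDelta (n : ℕ) (x : Fin n → ℝ) (i j : Fin n) (h : i ≠ j) :
    ∑ p : {s : Finset (Fin n) // s.card = 2},
      ((if p.val = {i, j} then (1 : ℝ) else 0)) * ∑ i ∈ p.val, x i = x i + x j := by
  rw [Finset.sum_eq_single (⟨{i, j}, Finset.card_pair h⟩ : {s : Finset (Fin n) // s.card = 2})]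
  · simp [Finset.sum_pair h]
  · intro b _ hb
    have : b.val ≠ {i, j} := fun hh => hb (Subtype.ext hh)
    simp [this]
  · simp

/-- A symmetric function satisfying the four-point relations has the form `f i + f j + c`. -/
lemma four_point_split {n : ℕ} {Q : Type*} [AddCommGroup Q] (e : Fin n → Fin n → Q)
    (hs : ∀ i j, e i j = e j i)
    (hr : ∀ i j k l : Fin n, i ≠ j → i ≠ k → i ≠ l → j ≠ k → j ≠ l → k ≠ l →
      e i j + e k l = e i k + e j l) :
    ∃ (f : Fin n → Q) (c : Q), ∀ i j, i ≠ j → e i j = f i + f j + c := by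
  classical
  rcases n with _ | n
  · exact ⟨fun _ => 0, 0, fun i => i.elim0⟩
  have key : ∀ i j k : Fin (n+1), i ≠ 0 → j ≠ 0 → k ≠ 0 → i ≠ j → i ≠ k →
      e 0 i + e 0 j - e i j = e 0 i + e 0 k - e i k := by
    intro i j k hi hj hk hij hik
    by_cases hjk : j = k
    · rw [hjk]
    have h := hr 0 j k i hj.symm hk.symm hi.symm hjk hij.symm hik.symm
    rw [hs k i, hs j i] at h
    rw [add_sub_assoc, add_sub_assoc, add_right_inj, sub_eq_sub_iff_add_eq_add]
    exact h
  have sym : ∀ i j : Fin (n+1), e 0 i + e 0 j - e i j = e 0 j + e 0 i - e j i := by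
    intro i j
    rw [hs i j, add_comm]
  obtain ⟨c, hc⟩ : ∃ c, ∀ i j : Fin (n+1), i ≠ 0 → j ≠ 0 → i ≠ j →
      e 0 i + e 0 j - e i j = c := by
    by_cases hex : ∃ i j : Fin (n+1), i ≠ 0 ∧ j ≠ 0 ∧ i ≠ j
    · obtain ⟨k, l, hk, hl, hkl⟩ := hex
      refine ⟨e 0 k + e 0 l - e k l, fun i j hi hj hij => ?_⟩
      by_cases hik : i = k
      · subst hik
        exact key _ _ _ hi hj hl hij hkl
      · rw [key i j k hi hj hk hij hik, sym i k]
        exact key _ _ _ hk hi hl (Ne.symm hik) hkl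
    · exact ⟨0, fun i j hi hj hij => (hex ⟨i, j, hi, hj, hij⟩).elim⟩
  refine ⟨fun i => if i = 0 then 0 else e 0 i - c, c, fun i j hij => ?_⟩
  by_cases hi : i = 0
  · subst hi
    simp [hij.symm]
  by_cases hj : j = 0
  · subst hj
    simp [hi, hs i 0]
  · simp only [hi, hj, if_false]
    rw [← hc i j hi hj hij]
    abel

lemma sum_smul_split {n : ℕ} {Q : Type*} [AddCommGroup Q]
    (a : {s : Finset (Fin n) // s.card = 2} → ℤ) (f : Fin n → Q) (c : Q)
    (hdeg : ∀ i, ∑ p : {s : Finset (Fin n) // s.card = 2},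
        (if i ∈ p.val then a p else 0) = 0)
    (htot : ∑ p : {s : Finset (Fin n) // s.card = 2}, a p = 0) :
    ∑ p : {s : Finset (Fin n) // s.card = 2}, a p • (∑ i ∈ p.val, f i + c) = 0 := by
  simp only [smul_add, Finset.sum_add_distrib]
  rw [← Finset.sum_smul, htot, zero_smul, add_zero]
  have : ∀ p : {s : Finset (Fin n) // s.card = 2},
      a p • ∑ i ∈ p.val, f i = ∑ i, (if i ∈ p.val then a p else 0) • f i := by
    intro p
    simp [Finset.smul_sum, ite_smul, Finset.sum_ite_mem]
  simp only [this]
  rw [Finset.sum_comm]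
  simp only [← Finset.sum_smul, hdeg, zero_smul, Finset.sum_const_zero]

/-- For every `n`, an integer coefficient vector
`a : P → ℤ` (where `P` is the set of 2-element subsets of `Fin n`) yields an
integral linear functional on `ℝ^P` vanishing on the image of
`φ : ℝⁿ → ℝ^P`, `φ(x)_{{i,j}} = x_i + x_j`, if and only if `a` lies in the
additive subgroup generated by the vectors
`δ_{{i,j}} + δ_{{k,l}} − δ_{{i,k}} − δ_{{j,l}}` for pairwise distinct
`i, j, k, l ∈ Fin n`. -/
theorem integral_functionals_vanishing_on_distance_image (n : ℕ)
    (a : {s : Finset (Fin n) // s.card = 2} → ℤ) :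
    (∀ x : Fin n → ℝ,
        ∑ p : {s : Finset (Fin n) // s.card = 2}, (a p : ℝ) * ∑ i ∈ p.val, x i = 0)
      ↔ a ∈ AddSubgroup.closure
          {g : {s : Finset (Fin n) // s.card = 2} → ℤ |
            ∃ i j k l : Fin n,
              i ≠ j ∧ i ≠ k ∧ i ≠ l ∧ j ≠ k ∧ j ≠ l ∧ k ≠ l ∧
              g = fun q =>
                (if q.val = {i, j} then 1 else 0) + (if q.val = {k, l} then 1 else 0)
                  - (if q.val = {i, k} then 1 else 0)
                  - (if q.val = {j, l} then 1 else 0)} := by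
  classical
  constructor
  · intro H
    set S := AddSubgroup.closure
          {g : {s : Finset (Fin n) // s.card = 2} → ℤ |
            ∃ i j k l : Fin n,
              i ≠ j ∧ i ≠ k ∧ i ≠ l ∧ j ≠ k ∧ j ≠ l ∧ k ≠ l ∧
              g = fun q =>
                (if q.val = {i, j} then 1 else 0) + (if q.val = {k, l} then 1 else 0)
                  - (if q.val = {i, k} then 1 else 0)
                  - (if q.val = {j, l} then 1 else 0)} with hS
    let π := QuotientAddGroup.mk' S
    obtain ⟨f, c, hf⟩ := four_point_split (fun i j => π (pairDelta n {i, j}))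
      (fun i j => by simp only [Finset.pair_comm]) (by
        intro i j k l h1 h2 h3 h4 h5 h6
        have hm : pairDelta n {i, j} + pairDelta n {k, l} - pairDelta n {i, k}
            - pairDelta n {j, l} ∈ S :=
          AddSubgroup.subset_closure ⟨i, j, k, l, h1, h2, h3, h4, h5, h6, rfl⟩
        have h0 := (QuotientAddGroup.eq_zero_iff _).2 hm
        change π _ = 0 at h0
        rw [map_sub, map_sub, map_add, sub_sub, sub_eq_zero] at h0
        exact h0)
    have hdeg : ∀ i, ∑ p : {s : Finset (Fin n) // s.card = 2},
        (if i ∈ p.val then a p else 0) = 0 := by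
      intro i
      have h := H (fun j => if j = i then 1 else 0)
      simp only [Finset.sum_ite_eq', mul_ite, mul_one, mul_zero] at h
      exact_mod_cast h
    have htot : ∑ p : {s : Finset (Fin n) // s.card = 2}, a p = 0 := by
      have h := H (fun _ => 1)
      have h2 : ∑ p : {s : Finset (Fin n) // s.card = 2}, (a p : ℝ) * 2 = 0 := by
        rw [← h]
        refine Finset.sum_congr rfl fun p _ => ?_
        simp [p.2]
      rw [← Finset.sum_mul] at h2
      have h3 : ∑ p : {s : Finset (Fin n) // s.card = 2}, (a p : ℝ) = 0 := by linarith
      exact_mod_cast h3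
    have hπ : ∀ p : {s : Finset (Fin n) // s.card = 2},
        π (pairDelta n p.val) = ∑ i ∈ p.val, f i + c := by
      rintro ⟨s, hs⟩
      obtain ⟨i, j, hij, rfl⟩ := Finset.card_eq_two.1 hs
      rw [Finset.sum_pair hij]
      exact hf i j hij
    have ha : a = ∑ p : {s : Finset (Fin n) // s.card = 2}, a p • pairDelta n p.val := by
      funext q
      simp [Finset.sum_apply, pairDelta, ← Subtype.ext_iff]
    have hz : π a = 0 := by
      rw [ha, map_sum]
      simp only [map_zsmul, hπ]
      exact sum_smul_split a f c hdeg htot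
    exact (QuotientAddGroup.eq_zero_iff _).1 hz
  · intro h x
    induction h using AddSubgroup.closure_induction with
    | mem g hg =>
      obtain ⟨i, j, k, l, h1, h2, h3, h4, h5, h6, rfl⟩ := hg
      push_cast
      simp only [sub_mul, add_mul, Finset.sum_sub_distrib, Finset.sum_add_distrib]
      rw [sum_pairDelta n x i j h1, sum_pairDelta n x k l h6, sum_pairDelta n x i k h2,
        sum_pairDelta n x j l h5]
      ring
    | zero => simp
    | add u v _ _ hu hv =>
      simp only [Pi.add_apply, Int.cast_add, add_mul, Finset.sum_add_distrib, hu, hv, add_zero]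
    | neg u _ hu =>
      simp only [Pi.neg_apply, Int.cast_neg, neg_mul, Finset.sum_neg_distrib, hu, neg_zero]
end

section
/- For every a ∈ ℝ and every subset U ⊆ ℝ² that is a neighborhood of the diagonal point (a,a), there do not exist functions f : ℝ → ℝ and g : ℝ → ℝ such that min(x,y) = f(x) + g(y) for all (x,y) ∈ U. (In particular, the germ at a diagonal point of the piecewise linear function (x,y) ↦ min{x,y} on ℝ² is not a sum of pull-backs of functions along the two coordinate projections, so the morphism p⁻¹PL_ℝ ⊕ q⁻¹PL_ℝ → PL_{ℝ²} induced by the two projections p,q : ℝ² → ℝ is not an epimorphism of sheaves.) -/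
/-- For every `a : ℝ` and every neighborhood `U` of the
diagonal point `(a, a)` in `ℝ²`, there are no functions `f g : ℝ → ℝ` with
`min x y = f x + g y` for all `(x, y) ∈ U`. -/
theorem min_not_sum_of_pullbacks (a : ℝ) (U : Set (ℝ × ℝ))
    (hU : U ∈ nhds (a, a)) :
    ¬ ∃ f g : ℝ → ℝ, ∀ z ∈ U, min z.1 z.2 = f z.1 + g z.2 := by
  rintro ⟨f, g, h⟩
  obtain ⟨ε, hε, hb⟩ := Metric.mem_nhds_iff.mp hU
  have key : ∀ x y : ℝ, |x - a| < ε → |y - a| < ε → min x y = f x + g y := by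
    intro x y hx hy
    refine h (x, y) (hb ?_)
    rw [Metric.mem_ball, Prod.dist_eq, Real.dist_eq, Real.dist_eq]
    exact max_lt hx hy
  have h0 : |a - a| < ε := by simpa using hε
  have h1 : |a + ε / 2 - a| < ε := by
    rw [abs_lt]
    constructor <;> linarith
  have e1 := key _ _ h0 h0
  have e2 := key _ _ h0 h1
  have e3 := key _ _ h1 h0
  have e4 := key _ _ h1 h1
  rw [min_self] at e1 e4
  rw [min_eq_left (by linarith)] at e2
  rw [min_eq_right (by linarith)] at e3
  linarith
end
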